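/- For every integer n ≥ 1, the inversion walk on labelled tournaments on [n] satisfies d_n(n − 1) ≤ 0.751. -/

import Mathlib

open scoped BigOperators

/-- Index type for the coordinates of `F_2^{C(n,2)}`: unordered pairs `{i,j} ⊆ [n]`,
represented as ordered pairs `(i,j)` with `i < j`. -/
def PairIdx (n : ℕ) := {p : Fin n × Fin n // p.1 < p.2}

instance (n : ℕ) : Fintype (PairIdx n) := by unfold PairIdx; infer_instance
instance (n : ℕ) : DecidableEq (PairIdx n) := by unfold PairIdx; infer_instance

/-- The clique vector `v_X ∈ F_2^{C(n,2)}`: coordinate at `{i,j}` is `1` iff `{i,j} ⊆ X`. -/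
def cliqueVec (n : ℕ) (X : Finset (Fin n)) : PairIdx n → ZMod 2 :=
  fun p => if p.1.1 ∈ X ∧ p.1.2 ∈ X then 1 else 0

/-- `μ_t(z)`: the distribution at time `t` of the inversion walk started at `0`, i.e. the
probability that `v_{X_1} + ⋯ + v_{X_t} = z` for i.i.d. uniform subsets `X_1,…,X_t ⊆ [n]`.
This equals the `t`-fold convolution power of the step distribution. -/
noncomputable def invMu (n t : ℕ) (z : PairIdx n → ZMod 2) : ℝ :=
  ((Finset.univ.filter (fun Xs : Fin t → Finset (Fin n) =>
      ∑ i, cliqueVec n (Xs i) = z)).card : ℝ) / 2 ^ (n * t)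

/-- `d_n(t)`: total-variation distance of `μ_t` from the uniform distribution on
`F_2^{C(n,2)}`. -/
noncomputable def invDist (n t : ℕ) : ℝ :=
  (1 / 2) * ∑ z : PairIdx n → ZMod 2, |invMu n t z - ((2 : ℝ) ^ n.choose 2)⁻¹|

lemma card_pairIdx (n : ℕ) : Fintype.card (PairIdx n) = n.choose 2 := by
  have h : Fintype.card (PairIdx n) = Fintype.card (Σ i : Fin n, Fin i) :=
    Fintype.card_congr
      { toFun := fun p => ⟨p.1.2, ⟨p.1.1, p.2⟩⟩
        invFun := fun q => ⟨(⟨q.2, q.2.2.trans q.1.2⟩, q.1), q.2.2⟩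
        left_inv := fun _ => rfl
        right_inv := fun _ => rfl }
  rw [h, Fintype.card_sigma]
  simp only [Fintype.card_fin]
  rw [Fin.sum_univ_eq_sum_range (fun i => i), Finset.sum_range_id, Nat.choose_two_right]

lemma card_pairIdx_fun (n : ℕ) : Fintype.card (PairIdx n → ZMod 2) = 2 ^ n.choose 2 := by
  simp [card_pairIdx]

/-! ### The sign character of `ZMod 2` -/

/-- The nontrivial real character of `ZMod 2`. -/
def signChar (a : ZMod 2) : ℝ := if a = 0 then 1 else -1

@[simp] lemma signChar_zero : signChar 0 = 1 := by simp [signChar]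

@[simp] lemma signChar_one : signChar 1 = -1 := by simp [signChar]

lemma signChar_add (a b : ZMod 2) : signChar (a + b) = signChar a * signChar b := by
  have h : ∀ c : ZMod 2, c = 0 ∨ c = 1 := by decide
  rcases h a with rfl | rfl <;> rcases h b with rfl | rfl <;>
    simp [CharTwo.add_self_eq_zero]

lemma signChar_sum {ι : Type*} (s : Finset ι) (f : ι → ZMod 2) :
    signChar (∑ i ∈ s, f i) = ∏ i ∈ s, signChar (f i) := by
  classical
  induction s using Finset.induction_on with
  | empty => simp
  | insert a s ha ih => rw [Finset.sum_insert ha, Finset.prod_insert ha, signChar_add, ih]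

lemma abs_signChar (a : ZMod 2) : |signChar a| = 1 := by
  unfold signChar; split_ifs <;> simp

/-- Orthogonality of the characters of `ι → ZMod 2`. -/
lemma sum_signChar_dotProduct {ι : Type*} [Fintype ι] [DecidableEq ι] (w : ι → ZMod 2) :
    ∑ A : ι → ZMod 2, signChar (∑ p, A p * w p) =
      if w = 0 then 2 ^ Fintype.card ι else 0 := by
  have hfactor (b : ZMod 2) : ∑ a : ZMod 2, signChar (a * b) = if b = 0 then 2 else 0 := by
    have huniv : (Finset.univ : Finset (ZMod 2)) = {0, 1} := rfl
    rw [huniv, Finset.sum_pair zero_ne_one]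
    have h : b = 0 ∨ b = 1 := by revert b; decide
    rcases h with rfl | rfl <;> norm_num
  simp only [signChar_sum]
  rw [← Fintype.prod_sum (fun p a => signChar (a * w p))]
  simp only [hfactor]
  split_ifs with h
  · simp [h]
  · obtain ⟨p, hp⟩ := Function.ne_iff.mp h
    exact Finset.prod_eq_zero (Finset.mem_univ p) (if_neg hp)

lemma sum_signChar_linearMap {V : Type*} [AddCommGroup V] [Module (ZMod 2) V] [Fintype V]
    (f : V →ₗ[ZMod 2] ZMod 2) [Decidable (f = 0)] :
    ∑ x, signChar (f x) = if f = 0 then (Fintype.card V : ℝ) else 0 := by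
  split_ifs with h
  · simp [h]
  · obtain ⟨x₀, hx₀⟩ : ∃ x, f x ≠ 0 := by
      by_contra! h0
      exact h (LinearMap.ext h0)
    have hshift : ∑ x, signChar (f x) = ∑ x, signChar (f (x + x₀)) :=
      (Equiv.sum_comp (Equiv.addRight x₀) fun x => signChar (f x)).symm
    have hneg : signChar (f x₀) = -1 := if_neg hx₀
    simp only [map_add, signChar_add, hneg, ← Finset.sum_mul] at hshift
    linarith

/-! ### Quadratic forms attached to graphs -/

/-- The quadratic form `∑_{i<j} A_{ij} x_i x_j`. -/
def graphForm {n : ℕ} (A : PairIdx n → ZMod 2) (x : Fin n → ZMod 2) : ZMod 2 :=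
  ∑ p, A p * (x p.1.1 * x p.1.2)

/-- The polar form of `graphForm A`. -/
def graphPolar {n : ℕ} (A : PairIdx n → ZMod 2) :
    (Fin n → ZMod 2) →ₗ[ZMod 2] (Fin n → ZMod 2) →ₗ[ZMod 2] ZMod 2 :=
  LinearMap.mk₂ (ZMod 2)
    (fun x y => ∑ p, A p * (x p.1.1 * y p.1.2 + x p.1.2 * y p.1.1))
    (fun x x' y => by
      rw [← Finset.sum_add_distrib]
      exact Finset.sum_congr rfl fun p _ => by simp only [Pi.add_apply]; ring)
    (fun c x y => by
      rw [Finset.smul_sum]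
      exact Finset.sum_congr rfl fun p _ => by simp only [Pi.smul_apply, smul_eq_mul]; ring)
    (fun x y y' => by
      rw [← Finset.sum_add_distrib]
      exact Finset.sum_congr rfl fun p _ => by simp only [Pi.add_apply]; ring)
    (fun c x y => by
      rw [Finset.smul_sum]
      exact Finset.sum_congr rfl fun p _ => by simp only [Pi.smul_apply, smul_eq_mul]; ring)

lemma graphPolar_apply {n : ℕ} (A : PairIdx n → ZMod 2) (x y : Fin n → ZMod 2) :
    graphPolar A x y = ∑ p, A p * (x p.1.1 * y p.1.2 + x p.1.2 * y p.1.1) := rfl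

lemma graphPolar_comm {n : ℕ} (A : PairIdx n → ZMod 2) (x y : Fin n → ZMod 2) :
    graphPolar A x y = graphPolar A y x := by
  simp only [graphPolar_apply]
  exact Finset.sum_congr rfl fun p _ => by ring

lemma graphPolar_self {n : ℕ} (A : PairIdx n → ZMod 2) (x : Fin n → ZMod 2) :
    graphPolar A x x = 0 := by
  rw [graphPolar_apply]
  refine Finset.sum_eq_zero fun p _ => ?_
  rw [mul_comm (x p.1.2), CharTwo.add_self_eq_zero, mul_zero]

lemma graphPolar_sub {n : ℕ} (A B : PairIdx n → ZMod 2) :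
    graphPolar (A - B) = graphPolar A - graphPolar B := by
  refine LinearMap.ext₂ fun x y => ?_
  simp only [LinearMap.sub_apply, graphPolar_apply, ← Finset.sum_sub_distrib, Pi.sub_apply,
    sub_mul]

lemma graphPolar_single {n : ℕ} (A : PairIdx n → ZMod 2) (p : PairIdx n) :
    graphPolar A (Pi.single p.1.1 1) (Pi.single p.1.2 1) = A p := by
  rw [graphPolar_apply, Finset.sum_eq_single p]
  · have h := p.2.ne
    simp [h]
  · intro q _ hqp
    have hq := q.2
    have hp := p.2
    have h1 : ¬(q.1.1 = p.1.1 ∧ q.1.2 = p.1.2) := fun h =>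
      hqp (Subtype.ext (Prod.ext h.1 h.2))
    have h2 : ¬(q.1.2 = p.1.1 ∧ q.1.1 = p.1.2) := fun h => by
      rw [h.1, h.2] at hq
      exact lt_asymm hq hp
    simp only [Pi.single_apply]
    rw [ite_zero_mul_ite_zero, ite_zero_mul_ite_zero, if_neg h1, if_neg h2]
    simp
  · simp

lemma graphPolar_eq_zero_iff {n : ℕ} {A : PairIdx n → ZMod 2} : graphPolar A = 0 ↔ A = 0 := by
  refine ⟨fun h => funext fun p => ?_, fun h => ?_⟩
  · rw [← graphPolar_single A p, h]; rfl
  · refine LinearMap.ext₂ fun x y => ?_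
    simp [graphPolar_apply, h]

lemma graphForm_add {n : ℕ} (A : PairIdx n → ZMod 2) (x d : Fin n → ZMod 2) :
    graphForm A (x + d) = graphForm A x + graphForm A d + graphPolar A d x := by
  simp only [graphForm, graphPolar_apply, ← Finset.sum_add_distrib]
  exact Finset.sum_congr rfl fun p _ => by simp only [Pi.add_apply]; ring

open Classical in
/-- The squared bias of a quadratic form is controlled by the size of its radical. -/
lemma sq_sum_signChar_graphForm_le {n : ℕ} (A : PairIdx n → ZMod 2) :
    (∑ x, signChar (graphForm A x)) ^ 2 ≤
      2 ^ n * (Finset.univ.filter fun d => graphPolar A d = 0).card := by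
  have hsq : (∑ x, signChar (graphForm A x)) ^ 2 =
      ∑ d, signChar (graphForm A d) * ∑ x, signChar (graphPolar A d x) := by
    rw [sq, Finset.sum_mul_sum]
    simp only [Finset.mul_sum]
    rw [Finset.sum_comm]
    have hshift (x : Fin n → ZMod 2) :
        ∑ y, signChar (graphForm A y) * signChar (graphForm A x) =
          ∑ d, signChar (graphForm A d) * signChar (graphPolar A d x) := by
      rw [← Equiv.sum_comp (Equiv.addLeft x)
        fun y => signChar (graphForm A y) * signChar (graphForm A x)]
      refine Finset.sum_congr rfl fun d _ => ?_
      have hone : signChar (graphForm A x) * signChar (graphForm A x) = 1 := by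
        rw [← abs_mul_abs_self, abs_signChar, one_mul]
      simp only [Equiv.coe_addLeft, graphForm_add, signChar_add]
      linear_combination (signChar (graphForm A d) * signChar (graphPolar A d x)) * hone
    rw [Finset.sum_congr rfl fun x _ => hshift x, Finset.sum_comm]
  rw [hsq, Finset.card_filter, Nat.cast_sum, Finset.mul_sum]
  refine Finset.sum_le_sum fun d _ => ?_
  rw [sum_signChar_linearMap]
  have hle : signChar (graphForm A d) ≤ 1 := (le_abs_self _).trans (abs_signChar _).le
  split_ifs
  · simpa using hle
  · simp

/-! ### Counting alternating forms with prescribed radical vectors -/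

open Classical in
lemma card_le_ker_graphPolar_le {n k : ℕ} (W : Submodule (ZMod 2) (Fin n → ZMod 2))
    (hk : Module.finrank (ZMod 2) W + k = n) :
    (Finset.univ.filter fun A : PairIdx n → ZMod 2 => W ≤ LinearMap.ker (graphPolar A)).card ≤
      2 ^ k.choose 2 := by
  obtain ⟨C, hC⟩ := Submodule.exists_isCompl W
  have hCk : Module.finrank (ZMod 2) C = k := by
    have h := Submodule.finrank_add_eq_of_isCompl hC
    rw [Module.finrank_fin_fun] at h
    omega
  let b := Module.finBasisOfFinrankEq (ZMod 2) C hCk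
  rw [← card_pairIdx_fun k, ← Finset.card_univ]
  refine Finset.card_le_card_of_injOn
    (fun A p => graphPolar A (b p.1.1 : Fin n → ZMod 2) (b p.1.2)) (by simp) ?_
  intro A hA B hB hAB
  simp only [Finset.coe_filter, Finset.mem_univ, true_and, Set.mem_ofPred_eq] at hA hB
  set D := graphPolar (A - B) with hD
  have hW : W ≤ LinearMap.ker D := fun w hw => by
    have h1 := hA hw
    have h2 := hB hw
    rw [LinearMap.mem_ker] at h1 h2 ⊢
    rw [hD, graphPolar_sub, LinearMap.sub_apply, h1, h2, sub_zero]
  have hlt (i j : Fin k) (hij : i < j) : D (b i) (b j) = 0 := by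
    have h := congrFun hAB ⟨(i, j), hij⟩
    rw [hD, graphPolar_sub, LinearMap.sub_apply, LinearMap.sub_apply]
    exact sub_eq_zero.mpr h
  have hbb (i j : Fin k) : D (b i) (b j) = 0 := by
    rcases lt_trichotomy i j with h | h | h
    · exact hlt i j h
    · rw [h]; exact graphPolar_self _ _
    · rw [hD, graphPolar_comm]; exact hlt j i h
  have hspan : Submodule.span (ZMod 2) (Set.range fun i => (b i : Fin n → ZMod 2)) = C := by
    have h := congrArg (Submodule.map C.subtype) b.span_eq
    rw [Submodule.map_span, ← Set.range_comp, Submodule.map_top, Submodule.range_subtype] at h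
    exact h
  have hker (U : Submodule (ZMod 2) (Fin n → ZMod 2)) (hU : W ≤ U)
      (hb : ∀ i, (b i : Fin n → ZMod 2) ∈ U) : U = ⊤ := by
    refine top_le_iff.mp (hC.sup_eq_top ▸ sup_le hU ?_)
    rw [← hspan, Submodule.span_le]
    rintro _ ⟨i, rfl⟩
    exact hb i
  have hDb (i : Fin k) : D (b i) = 0 := by
    refine LinearMap.ker_eq_top.mp (hker _ (fun w hw => ?_) (hbb i))
    rw [LinearMap.mem_ker, hD, graphPolar_comm, ← hD, LinearMap.mem_ker.mp (hW hw)]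
    rfl
  have hD0 : D = 0 := LinearMap.ker_eq_top.mp (hker _ hW hDb)
  exact sub_eq_zero.mp (graphPolar_eq_zero_iff.mp hD0)

open Classical in
/-- Adding random vectors to the radical one at a time: the total count of pairs `(Y, A)` such
that the radical of `A` contains `W` and every `Y i`. -/
lemma sum_card_radical_le {n : ℕ} (s : ℕ) :
    ∀ (k : ℕ) (W : Submodule (ZMod 2) (Fin n → ZMod 2)),
      Module.finrank (ZMod 2) W + k = n → s ≤ k →
      ∑ Y : Fin s → Fin n → ZMod 2, ((Finset.univ.filter fun A : PairIdx n → ZMod 2 =>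
          W ≤ LinearMap.ker (graphPolar A) ∧ ∀ i, graphPolar A (Y i) = 0).card : ℝ) ≤
        2 ^ (n * s) * (2 ^ (k - s).choose 2 * ∏ i ∈ Finset.range s, (1 + (1 / 2) ^ (i + 1))) := by
  induction s with
  | zero =>
    intro k W hk _
    have h := card_le_ker_graphPolar_le W hk
    simpa using (by exact_mod_cast h :
      ((Finset.univ.filter fun A : PairIdx n → ZMod 2 =>
        W ≤ LinearMap.ker (graphPolar A)).card : ℝ) ≤ 2 ^ k.choose 2)
  | succ s ih =>
    intro k W hk hsk
    obtain ⟨j, rfl⟩ : ∃ j, k = j + (s + 1) := ⟨k - (s + 1), by omega⟩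
    set P : ℝ := ∏ i ∈ Finset.range s, (1 + (1 / 2 : ℝ) ^ (i + 1)) with hP
    have hP0 : 0 ≤ P := Finset.prod_nonneg fun i _ => by positivity
    set G : (Fin n → ZMod 2) → ℝ := fun v => ∑ Y : Fin s → Fin n → ZMod 2,
      ((Finset.univ.filter fun A : PairIdx n → ZMod 2 =>
        W ⊔ Submodule.span (ZMod 2) {v} ≤ LinearMap.ker (graphPolar A) ∧
          ∀ i, graphPolar A (Y i) = 0).card : ℝ) with hG
    have hsplit : ∑ Y : Fin (s + 1) → Fin n → ZMod 2,
        ((Finset.univ.filter fun A : PairIdx n → ZMod 2 =>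
          W ≤ LinearMap.ker (graphPolar A) ∧ ∀ i, graphPolar A (Y i) = 0).card : ℝ) =
        ∑ v, G v := by
      rw [← (Fin.consEquiv fun _ : Fin (s + 1) => Fin n → ZMod 2).sum_comp,
        Fintype.sum_prod_type]
      simp [hG, Fin.consEquiv, Fin.forall_fin_succ, and_assoc]
    have hGle (v : Fin n → ZMod 2) : G v ≤
        (if v ∈ W then 2 ^ (n * s) * (2 ^ (j + 1).choose 2 * P) else 0) +
          2 ^ (n * s) * (2 ^ j.choose 2 * P) := by
      by_cases hv : v ∈ W
      · have hle := ih (j + (s + 1)) (W ⊔ Submodule.span (ZMod 2) {v})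
          (by rwa [sup_eq_left.mpr ((Submodule.span_singleton_le_iff_mem v W).mpr hv)])
          (by omega)
        rw [show j + (s + 1) - s = j + 1 by omega] at hle
        rw [if_pos hv]
        have : (0 : ℝ) ≤ 2 ^ (n * s) * (2 ^ j.choose 2 * P) := by positivity
        linarith
      · have hle := ih (j + s) (W ⊔ Submodule.span (ZMod 2) {v})
          (by rw [Submodule.finrank_sup_span_singleton hv]; omega) (by omega)
        rw [show j + s - s = j by omega] at hle
        rw [if_neg hv, zero_add]
        exact hle
    have hcardW : ((Finset.univ.filter fun v => v ∈ W).card : ℝ) =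
        2 ^ Module.finrank (ZMod 2) W := by
      rw [← Fintype.card_subtype]
      have h := Module.card_eq_pow_finrank (K := ZMod 2) (V := W)
      rw [ZMod.card] at h
      exact_mod_cast h
    rw [hsplit]
    calc ∑ v, G v ≤ ∑ v : Fin n → ZMod 2,
          ((if v ∈ W then 2 ^ (n * s) * (2 ^ (j + 1).choose 2 * P) else 0) +
            2 ^ (n * s) * (2 ^ j.choose 2 * P)) := Finset.sum_le_sum fun v _ => hGle v
      _ = 2 ^ Module.finrank (ZMod 2) W * (2 ^ (n * s) * (2 ^ (j + 1).choose 2 * P)) +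
            2 ^ n * (2 ^ (n * s) * (2 ^ j.choose 2 * P)) := by
          rw [Finset.sum_add_distrib, ← Finset.sum_filter, Finset.sum_const, Finset.sum_const,
            nsmul_eq_mul, nsmul_eq_mul, hcardW]
          simp
      _ = _ := by
          rw [Finset.prod_range_succ, ← hP, show j + (s + 1) - (s + 1) = j by omega,
            Nat.choose_succ_succ' j 1, Nat.choose_one_right]
          have hn : (2 : ℝ) ^ n = 2 ^ Module.finrank (ZMod 2) W * 2 ^ j * 2 ^ (s + 1) := by
            rw [← pow_add, ← pow_add]; congr 1; omega
          have hs : (2 : ℝ) ^ (s + 1) * (1 / 2) ^ (s + 1) = 1 := by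
            rw [← mul_pow]; norm_num
          rw [Nat.mul_succ, pow_add 2 (n * s) n, pow_add 2 j, hn]
          linear_combination (-(2 : ℝ) ^ Module.finrank (ZMod 2) W * 2 ^ j * 2 ^ (n * s) *
            2 ^ j.choose 2 * P) * hs

lemma prod_one_add_half_pow_le (s : ℕ) :
    ∏ i ∈ Finset.range s, (1 + (1 / 2 : ℝ) ^ (i + 1)) ≤ Real.exp 1 := by
  calc ∏ i ∈ Finset.range s, (1 + (1 / 2 : ℝ) ^ (i + 1))
      ≤ ∏ i ∈ Finset.range s, Real.exp ((1 / 2) ^ (i + 1)) :=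
        Finset.prod_le_prod (fun i _ => by positivity) fun i _ => by
          rw [add_comm]; exact Real.add_one_le_exp _
    _ = Real.exp (∑ i ∈ Finset.range s, (1 / 2 : ℝ) ^ (i + 1)) := (Real.exp_sum _ _).symm
    _ ≤ Real.exp 1 := by
        refine Real.exp_le_exp.mpr ?_
        simp only [pow_succ, ← Finset.sum_mul]
        rw [geom_sum_eq (by norm_num)]
        have : (0 : ℝ) ≤ (1 / 2) ^ s := by positivity
        rw [show (1 / 2 : ℝ) - 1 = -(1 / 2) by norm_num, div_neg, neg_mul,
          div_mul_cancel₀ _ (by norm_num)]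
        linarith

/-! ### Fourier analysis of the walk -/

/-- Subsets of `Fin n` as vectors over `ZMod 2`. -/
def finsetEquivFun (n : ℕ) : Finset (Fin n) ≃ (Fin n → ZMod 2) where
  toFun X i := if i ∈ X then 1 else 0
  invFun x := Finset.univ.filter fun i => x i = 1
  left_inv X := by ext i; simp
  right_inv x := by
    funext i
    have h : ∀ a : ZMod 2, (if a = 1 then 1 else 0) = a := by decide
    simpa using h (x i)

lemma sum_mul_cliqueVec {n : ℕ} (A : PairIdx n → ZMod 2) (X : Finset (Fin n)) :
    ∑ p, A p * cliqueVec n X p = graphForm A (finsetEquivFun n X) := by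
  refine Finset.sum_congr rfl fun p _ => ?_
  simp only [cliqueVec, finsetEquivFun, Equiv.coe_fn_mk]
  rw [ite_zero_mul_ite_zero, mul_one]

/-- The unnormalised Fourier coefficients of the walk. -/
lemma sum_signChar_sum_cliqueVec {n : ℕ} (t : ℕ) (A : PairIdx n → ZMod 2) :
    ∑ Xs : Fin t → Finset (Fin n), signChar (∑ p, A p * (∑ i, cliqueVec n (Xs i)) p) =
      (∑ x, signChar (graphForm A x)) ^ t := by
  rw [← (finsetEquivFun n).sum_comp, Fintype.sum_pow]
  refine Finset.sum_congr rfl fun Xs _ => ?_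
  rw [← signChar_sum]
  congr 1
  simp only [Finset.sum_apply, Finset.mul_sum]
  rw [Finset.sum_comm]
  exact Finset.sum_congr rfl fun i _ => sum_mul_cliqueVec A (Xs i)

/-- Parseval's identity for the fibre sizes of a map into `ι → ZMod 2`. -/
lemma sum_sq_card_fiber {ι α : Type*} [Fintype ι] [DecidableEq ι] [Fintype α]
    (g : α → ι → ZMod 2) :
    2 ^ Fintype.card ι * ∑ z, ((Finset.univ.filter fun a => g a = z).card : ℝ) ^ 2 =
      ∑ A : ι → ZMod 2, (∑ a, signChar (∑ p, A p * g a p)) ^ 2 := by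
  have hpair (a b : α) : ∑ A : ι → ZMod 2,
      signChar (∑ p, A p * g a p) * signChar (∑ p, A p * g b p) =
        if g a = g b then 2 ^ Fintype.card ι else 0 := by
    simp only [← signChar_add, ← Finset.sum_add_distrib, ← mul_add]
    have h := sum_signChar_dotProduct (g a + g b)
    simp only [Pi.add_apply] at h
    rw [h]
    have hiff : g a + g b = 0 ↔ g a = g b := by
      simp only [funext_iff, Pi.add_apply, Pi.zero_apply]
      exact forall_congr' fun p => CharTwo.add_eq_zero
    simp only [hiff]
  have hrhs : ∑ A : ι → ZMod 2, (∑ a, signChar (∑ p, A p * g a p)) ^ 2 =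
      ∑ a, ∑ b, if g a = g b then (2 : ℝ) ^ Fintype.card ι else 0 := by
    simp only [sq, Finset.sum_mul_sum]
    rw [Finset.sum_comm]
    refine Finset.sum_congr rfl fun a _ => ?_
    rw [Finset.sum_comm]
    exact Finset.sum_congr rfl fun b _ => hpair a b
  have hlhs (z : ι → ZMod 2) : ((Finset.univ.filter fun a => g a = z).card : ℝ) ^ 2 =
      ∑ a, ∑ b, if g a = z then (if g b = z then (1 : ℝ) else 0) else 0 := by
    rw [sq, Finset.card_filter, Nat.cast_sum, Finset.sum_mul_sum]
    refine Finset.sum_congr rfl fun a _ => Finset.sum_congr rfl fun b _ => ?_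
    split_ifs <;> simp
  rw [hrhs]
  simp only [hlhs]
  rw [Finset.sum_comm, Finset.mul_sum]
  refine Finset.sum_congr rfl fun a _ => ?_
  rw [Finset.sum_comm, Finset.mul_sum]
  refine Finset.sum_congr rfl fun b _ => ?_
  rw [Finset.sum_ite_eq]
  simp [eq_comm]

lemma sum_invMu (n t : ℕ) : ∑ z, invMu n t z = 1 := by
  simp only [invMu]
  rw [← Finset.sum_div, ← Nat.cast_sum, ← Finset.card_eq_sum_card_fiberwise (by simp)]
  simp [← pow_mul]

/-- The collision probability of the walk, for `t ≤ n`. -/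
lemma sum_sq_invMu_le {n t : ℕ} (ht : t ≤ n) :
    2 ^ n.choose 2 * ∑ z, invMu n t z ^ 2 ≤ 2 ^ (n - t).choose 2 * Real.exp 1 := by
  classical
  have hsq : 2 ^ n.choose 2 * ∑ z, invMu n t z ^ 2 =
      (∑ A : PairIdx n → ZMod 2, (∑ x, signChar (graphForm A x)) ^ (2 * t)) /
        (2 ^ (n * t)) ^ 2 := by
    simp only [invMu, div_pow]
    rw [← Finset.sum_div, ← mul_div_assoc, ← card_pairIdx, sum_sq_card_fiber]
    simp only [sum_signChar_sum_cliqueVec, ← pow_mul, mul_comm t 2]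
  have hpow (A : PairIdx n → ZMod 2) : (∑ x, signChar (graphForm A x)) ^ (2 * t) ≤
      2 ^ (n * t) * ∑ Y : Fin t → Fin n → ZMod 2,
        if ∀ i, graphPolar A (Y i) = 0 then 1 else 0 := by
    rw [pow_mul]
    refine (pow_le_pow_left₀ (sq_nonneg _) (sq_sum_signChar_graphForm_le A) t).trans_eq ?_
    rw [mul_pow, ← pow_mul, Finset.card_filter, Nat.cast_sum, Fintype.sum_pow]
    congr 1
    refine Finset.sum_congr rfl fun Y _ => ?_
    push_cast
    rw [Finset.prod_ite_zero]
    simp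
  have hcount := sum_card_radical_le (n := n) t n ⊥ (by simp) ht
  have hswap : ∑ A : PairIdx n → ZMod 2, ∑ Y : Fin t → Fin n → ZMod 2,
      (if ∀ i, graphPolar A (Y i) = 0 then (1 : ℝ) else 0) ≤
        2 ^ (n * t) * (2 ^ (n - t).choose 2 * Real.exp 1) := by
    rw [Finset.sum_comm]
    refine le_trans (le_of_eq ?_) (hcount.trans ?_)
    · refine Finset.sum_congr rfl fun Y _ => ?_
      simp
    · gcongr
      exact prod_one_add_half_pow_le t
  rw [hsq, div_le_iff₀ (by positivity)]
  calc ∑ A : PairIdx n → ZMod 2, (∑ x, signChar (graphForm A x)) ^ (2 * t)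
      ≤ ∑ A : PairIdx n → ZMod 2, 2 ^ (n * t) * ∑ Y : Fin t → Fin n → ZMod 2,
        (if ∀ i, graphPolar A (Y i) = 0 then (1 : ℝ) else 0) :=
        Finset.sum_le_sum fun A _ => hpow A
    _ ≤ 2 ^ (n * t) * (2 ^ (n * t) * (2 ^ (n - t).choose 2 * Real.exp 1)) := by
        rw [← Finset.mul_sum]; gcongr
    _ = _ := by ring

/-- The `L²` bound on the total-variation distance. -/
lemma sq_two_mul_invDist_le (n t : ℕ) :
    (2 * invDist n t) ^ 2 ≤ 2 ^ n.choose 2 * ∑ z, invMu n t z ^ 2 - 1 := by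
  have h := sq_sum_le_card_mul_sum_sq (s := Finset.univ)
    (f := fun z : PairIdx n → ZMod 2 => |invMu n t z - ((2 : ℝ) ^ n.choose 2)⁻¹|)
  rw [Finset.card_univ, card_pairIdx_fun] at h
  have hdist : 2 * invDist n t = ∑ z, |invMu n t z - ((2 : ℝ) ^ n.choose 2)⁻¹| := by
    rw [invDist]; ring
  rw [hdist]
  refine h.trans_eq ?_
  simp only [sq_abs, sub_sq, Finset.sum_add_distrib, Finset.sum_sub_distrib, ← Finset.sum_mul,
    ← Finset.mul_sum, sum_invMu, Finset.sum_const, Finset.card_univ, card_pairIdx_fun,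
    nsmul_eq_mul]
  push_cast
  field_simp
  ring

/-- For every `n ≥ 1`, the inversion walk satisfies `d_n(n - 1) ≤ 0.751`. -/
theorem inversion_walk_at_n_sub_one (n : ℕ) (hn : 1 ≤ n) :
    invDist n (n - 1) ≤ 0.751 := by
  have h1 := sq_two_mul_invDist_le n (n - 1)
  have h2 := sum_sq_invMu_le (Nat.sub_le n 1)
  rw [Nat.sub_sub_self hn, Nat.choose_eq_zero_of_lt one_lt_two, pow_zero, one_mul] at h2
  have h3 := Real.exp_one_lt_d9
  by_contra! h
  nlinarith
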